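/- Let N ≥ 2 and let {F_1, …, F_{N²−1}} be an orthonormal basis of the traceless matrices M_N⁰(ℂ) consisting of Hermitian matrices (for example, the Gell-Mann basis). Let H ∈ M_N(ℂ) be Hermitian, let C = (c_{ij}) be a positive semidefinite (N²−1)×(N²−1) complex matrix, and suppose the map L(ρ) = −i[H,ρ] + (1/2)·Σ_{i,j=1}^{N²−1} c_{ij}·([F_i, ρ·F_j] + [F_i·ρ, F_j]) satisfies L(I_N) = 0. Let Ĉ : M_N⁰(ℂ) → M_N⁰(ℂ) be the operator with Ĉ(F_j) = Σ_i c_{ij}·F_i, let S = {i : F_i is orthogonal to ker Ĉ}, and define K(ρ) = (1/2)·Σ_{i∈S} ([F_i, ρ·F_i] + [F_i·ρ, F_i]). Then ker L ⊆ ker K. -/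

import Mathlib

open Matrix
open scoped Classical ComplexOrder

noncomputable section

abbrev Mat (N : ℕ) := Matrix (Fin N) (Fin N) ℂ

/-- The Hilbert–Schmidt inner product `⟨A,B⟩ = Tr(A* B)`. -/
def hsInner {N : ℕ} (A B : Mat N) : ℂ := (Aᴴ * B).trace

/-- Commutator. -/
def mcomm {N : ℕ} (X Y : Mat N) : Mat N := X * Y - Y * X

theorem commute_of_unital_lindblad {N : ℕ} {ι : Type*} [Fintype ι] (V : ι → Mat N) (H ρ : Mat N)
    (hH : H.IsHermitian) (hV : ∑ k, V k * (V k)ᴴ = ∑ k, (V k)ᴴ * V k)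
    (hρ : -Complex.I • mcomm H ρ + (1 / 2 : ℂ) •
      ∑ k, (mcomm (V k) (ρ * (V k)ᴴ) + mcomm (V k * ρ) (V k)ᴴ) = 0) (k : ι) :
    V k * ρ = ρ * V k := by
  have trace_eq : (ρᴴ * (-Complex.I • mcomm H ρ + (1 / 2 : ℂ) •
      ∑ k, (mcomm (V k) (ρ * (V k)ᴴ) + mcomm (V k * ρ) (V k)ᴴ))).trace = 0 := by
    rw [hρ]; simp
  have trace_star_eq := congrArg star trace_eq
  rw [← Matrix.trace_conjTranspose] at trace_star_eq
  have hV' : ∑ k, (ρᴴ * ρ * (V k * (V k)ᴴ)).trace = ∑ k, (ρᴴ * ρ * ((V k)ᴴ * V k)).trace := by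
    simp only [← Matrix.trace_sum, ← Matrix.mul_sum, hV]
  have hdiss : ∑ k, ((V k * ρ - ρ * V k)ᴴ * (V k * ρ - ρ * V k)).trace = 0 := by
    have e1 (k : ι) : (ρᴴ * (ρ * ((V k)ᴴ * V k))).trace = (ρᴴ * ρ * ((V k)ᴴ * V k)).trace := by
      simp only [Matrix.mul_assoc]
    have e2 (k : ι) : ((V k)ᴴ * (V k * (ρᴴ * ρ))).trace = (ρᴴ * ρ * ((V k)ᴴ * V k)).trace := by
      rw [← Matrix.mul_assoc, Matrix.trace_mul_comm]
    have e3 (k : ι) : ((V k)ᴴ * (ρᴴ * (ρ * V k))).trace = (ρᴴ * ρ * (V k * (V k)ᴴ)).trace := by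
      rw [Matrix.trace_mul_comm]; simp only [Matrix.mul_assoc]
    have e4 (k : ι) : ((V k)ᴴ * (ρᴴ * (V k * ρ))).trace = (ρᴴ * (V k * (ρ * (V k)ᴴ))).trace := by
      rw [Matrix.trace_mul_comm]; simp only [Matrix.mul_assoc]
    have e5 (k : ι) : (V k * (ρᴴ * ((V k)ᴴ * ρ))).trace = (ρᴴ * ((V k)ᴴ * (ρ * V k))).trace := by
      rw [Matrix.trace_mul_comm]; simp only [Matrix.mul_assoc]
    have e6 : (H * (ρᴴ * ρ)).trace = (ρᴴ * (ρ * H)).trace := by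
      rw [Matrix.trace_mul_comm]; simp only [Matrix.mul_assoc]
    simp only [mcomm, Matrix.mul_add, Matrix.mul_sub, Matrix.sub_mul, Matrix.mul_smul,
      Matrix.mul_sum, Matrix.trace_add, Matrix.trace_sub, Matrix.trace_smul, Matrix.trace_sum,
      Matrix.conjTranspose_add, Matrix.conjTranspose_sub, Matrix.conjTranspose_smul,
      Matrix.conjTranspose_mul, Matrix.conjTranspose_sum, Matrix.conjTranspose_conjTranspose,
      hH.eq, Finset.sum_add_distrib, Finset.sum_sub_distrib, Matrix.mul_assoc, smul_eq_mul,
      star_neg, Complex.star_def, Complex.conj_I, star_zero, map_div₀, map_one, map_ofNat,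
      e1, e2, e3, e4, e5, e6] at trace_eq trace_star_eq hV' ⊢
    linear_combination hV' - trace_eq - trace_star_eq
  have hnonneg (k : ι) : 0 ≤ ((V k * ρ - ρ * V k)ᴴ * (V k * ρ - ρ * V k)).trace :=
    (Matrix.posSemidef_conjTranspose_mul_self _).trace_nonneg
  have hk := (Finset.sum_eq_zero_iff_of_nonneg fun k _ => hnonneg k).1 hdiss k (Finset.mem_univ k)
  exact sub_eq_zero.1 (Matrix.trace_conjTranspose_mul_self_eq_zero_iff.1 hk)

theorem exists_coeff_of_orthogonal_ker {ι : Type*} [Fintype ι] [DecidableEq ι] {R : Type*} [Field R]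
    (c : Matrix ι ι R) (i : ι) (h : ∀ x : ι → R, c *ᵥ x = 0 → x i = 0) :
    ∃ φ : ι → R, ∀ j, ∑ k, φ k * c k j = if i = j then 1 else 0 := by
  have hmem : (LinearMap.proj i : (ι → R) →ₗ[R] R) ∈
      LinearMap.range (Matrix.mulVecLin c).dualMap := by
    rw [LinearMap.range_dualMap_eq_dualAnnihilator_ker, Submodule.mem_dualAnnihilator]
    exact fun x hx => h x hx
  obtain ⟨f, hf⟩ := hmem
  refine ⟨fun k => f (Pi.single k 1), fun j => ?_⟩
  have hj := LinearMap.congr_fun hf (Pi.single j 1)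
  simp only [LinearMap.dualMap_apply, Matrix.mulVecLin_apply, Matrix.mulVec_single_one,
    LinearMap.proj_apply, Pi.single_apply] at hj
  rw [← hj, LinearMap.pi_apply_eq_sum_univ f]
  refine Finset.sum_congr rfl fun k _ => ?_
  rw [smul_eq_mul, mul_comm]
  congr 1
  refine congrArg f (funext fun l => ?_)
  simp [Pi.single_apply, eq_comm]

open scoped MatrixOrder Matrix.Norms.L2Operator in
theorem exists_eq_conjTranspose_mul_self {ι : Type*} [Fintype ι] {A : Matrix ι ι ℂ}
    (hA : A.PosSemidef) : ∃ B : Matrix ι ι ℂ, A = Bᴴ * B :=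
  CStarAlgebra.nonneg_iff_eq_star_mul_self.mp hA.nonneg

theorem sum_smul_eq_sum_of_eq_conjTranspose_mul_self {N : ℕ} {ι : Type*} [Fintype ι]
    (F : ι → Mat N) (hF : ∀ i, (F i).IsHermitian) (c : ι → ι → ℂ) (B : Matrix ι ι ℂ)
    (hB : Matrix.of c = Bᴴ * B) (T : Mat N →ₗ[ℂ] Mat N →ₗ[ℂ] Mat N) :
    ∑ i, ∑ j, c i j • T (F i) (F j) =
      ∑ k, T (∑ i, star (B k i) • F i) (∑ i, star (B k i) • F i)ᴴ := by
  have hc (i j : ι) : c i j = ∑ k, star (B k i) * B k j := by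
    have := congrFun (congrFun hB i) j
    simpa [Matrix.mul_apply] using this
  simp only [hc, Matrix.conjTranspose_sum, Matrix.conjTranspose_smul, (hF _).eq, star_star,
    map_sum, map_smul, LinearMap.sum_apply, LinearMap.smul_apply, Finset.sum_smul, smul_smul,
    Finset.smul_sum]
  rw [Finset.sum_congr rfl fun i _ => Finset.sum_comm, Finset.sum_comm]
  refine Finset.sum_congr rfl fun k _ => ?_
  rw [Finset.sum_comm]
  simp only [mul_comm]

/-- The dissipative part `[X, ρ Y] + [X ρ, Y]` as a bilinear map in `X` and `Y`. -/
def dissipator {N : ℕ} (ρ : Mat N) : Mat N →ₗ[ℂ] Mat N →ₗ[ℂ] Mat N :=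
  LinearMap.mk₂ ℂ (fun X Y => mcomm X (ρ * Y) + mcomm (X * ρ) Y)
    (fun _ _ _ => by simp only [mcomm]; noncomm_ring)
    (fun _ _ _ => by simp [mcomm, smul_sub, smul_add, Matrix.mul_assoc])
    (fun _ _ _ => by simp only [mcomm]; noncomm_ring)
    (fun _ _ _ => by simp [mcomm, smul_sub, smul_add, Matrix.mul_assoc])

/-- invariant states are invariant for the induced graph semigroup.
With `L` a GKSL generator written in a traceless Hermitian orthonormal basis with positive
semidefinite coefficient matrix `c`, satisfying `L(I) = 0`, and `K` the Hamiltonian-free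
generator with diagonal coefficient matrix supported on those `F_i` orthogonal to the kernel
of the coefficient operator `Ĉ`, we have `ker L ⊆ ker K`. -/
theorem stmt14 {N : ℕ} (hN : 2 ≤ N) (F : Fin (N ^ 2 - 1) → Mat N)
    (hFherm : ∀ i, (F i).IsHermitian) (hFtr : ∀ i, (F i).trace = 0)
    (hFon : ∀ i j, hsInner (F i) (F j) = if i = j then 1 else 0)
    (hFspan : ∀ A : Mat N, A.trace = 0 → A ∈ Submodule.span ℂ (Set.range F))
    (H : Mat N) (hH : H.IsHermitian)
    (c : Fin (N ^ 2 - 1) → Fin (N ^ 2 - 1) → ℂ)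
    (hc : (Matrix.of c).PosSemidef)
    (Chat : Mat N →ₗ[ℂ] Mat N) (hChat : ∀ j, Chat (F j) = ∑ i, c i j • F i)
    (hL1 : (-Complex.I • mcomm H 1 + (1 / 2 : ℂ) •
        ∑ i, ∑ j, c i j •
          (mcomm (F i) ((1 : Mat N) * F j) + mcomm (F i * (1 : Mat N)) (F j))) = 0) :
    ∀ ρ : Mat N,
      (-Complex.I • mcomm H ρ + (1 / 2 : ℂ) •
        ∑ i, ∑ j, c i j • (mcomm (F i) (ρ * F j) + mcomm (F i * ρ) (F j))) = 0 →
      ((1 / 2 : ℂ) •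
        ∑ i ∈ Finset.univ.filter
            (fun i => ∀ z : Mat N, z.trace = 0 → Chat z = 0 → hsInner (F i) z = 0),
          (mcomm (F i) (ρ * F i) + mcomm (F i * ρ) (F i))) = 0 := by
  intro ρ hρ
  obtain ⟨B, hB⟩ := exists_eq_conjTranspose_mul_self hc
  set V : Fin (N ^ 2 - 1) → Mat N := fun k => ∑ i, star (B k i) • F i with hVdef
  have hdiss (σ : Mat N) :
      ∑ i, ∑ j, c i j • (mcomm (F i) (σ * F j) + mcomm (F i * σ) (F j)) =
        ∑ k, (mcomm (V k) (σ * (V k)ᴴ) + mcomm (V k * σ) (V k)ᴴ) :=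
    sum_smul_eq_sum_of_eq_conjTranspose_mul_self F hFherm c B hB (dissipator σ)
  rw [hdiss] at hL1 hρ
  have hunital : ∑ k, V k * (V k)ᴴ = ∑ k, (V k)ᴴ * V k := by
    simp only [mcomm, Matrix.mul_one, Matrix.one_mul, sub_self, smul_zero, zero_add,
      ← two_smul ℂ, ← Finset.smul_sum, smul_smul, Finset.sum_sub_distrib] at hL1
    norm_num at hL1
    exact sub_eq_zero.1 hL1
  have hVcomm := commute_of_unital_lindblad V H ρ hH hunital hρ
  have hCcomm (k : Fin (N ^ 2 - 1)) : Commute (∑ j, c j k • F j) ρ := by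
    have hC : ∑ j, c j k • F j = ∑ l, B l k • V l := by
      have hcjk (j : Fin (N ^ 2 - 1)) : c j k = ∑ l, star (B l j) * B l k := by
        have := congrFun (congrFun hB j) k
        simpa [Matrix.mul_apply] using this
      simp only [hVdef, hcjk, Finset.sum_smul, Finset.smul_sum, smul_smul, mul_comm]
      exact Finset.sum_comm
    rw [hC]
    exact Commute.sum_left _ _ _ fun l _ => Commute.smul_left (hVcomm l) _
  rw [Finset.sum_eq_zero, smul_zero]
  intro i hi
  have hS := (Finset.mem_filter.1 hi).2
  obtain ⟨φ, hφ⟩ := exists_coeff_of_orthogonal_ker (Matrix.of c) i fun x hx => by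
    have hker : Chat (∑ j, x j • F j) = 0 := by
      have hx' (l : Fin (N ^ 2 - 1)) : ∑ j, x j * c l j = 0 := by
        simpa [Matrix.mulVec, dotProduct, mul_comm] using congrFun hx l
      simp only [map_sum, map_smul, hChat, Finset.smul_sum, smul_smul]
      rw [Finset.sum_comm]
      simp only [← Finset.sum_smul, hx', zero_smul, Finset.sum_const_zero]
    have h0 := hS (∑ j, x j • F j) (by simp [Matrix.trace_sum, hFtr]) hker
    have hsum : hsInner (F i) (∑ j, x j • F j) = ∑ j, x j * hsInner (F i) (F j) := by
      simp [hsInner, Matrix.mul_sum, Matrix.trace_sum]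
    simpa [hsum, hFon] using h0
  have hFi : F i = ∑ k, star (φ k) • ∑ j, c j k • F j := by
    have hcoeff (j : Fin (N ^ 2 - 1)) :
        ∑ k, star (φ k) * c j k = if i = j then 1 else 0 := by
      have h1 := congrArg star (hφ j)
      have h2 (k : Fin (N ^ 2 - 1)) : star (c k j) = c j k := hc.isHermitian.apply j k
      rw [star_sum] at h1
      simpa [h2, apply_ite, mul_comm] using h1
    simp only [Finset.smul_sum, smul_smul]
    rw [Finset.sum_comm]
    simp only [← Finset.sum_smul, hcoeff, ite_smul, one_smul, zero_smul, Finset.sum_ite_eq,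
      Finset.mem_univ, if_true]
  have hcomm : F i * ρ = ρ * F i := by
    have : Commute (F i) ρ := by
      rw [hFi]
      exact Commute.sum_left _ _ _ fun k _ => Commute.smul_left (hCcomm k) _
    exact this
  simp only [mcomm, hcomm, Matrix.mul_assoc]
  rw [← Matrix.mul_assoc (F i) ρ (F i), hcomm, Matrix.mul_assoc]
  simp
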